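/- arXiv:2309.03541 — 2 statements merged into one kernel-verified Lean document; each statement's English description precedes it below -/
import Mathlib

section
/- The quantity c_l := sup{ c ≤ κ²/(2σ²) : Λ(c) < ε_J and M_J(Λ(c)) ≤ (β/α)·exp(α/β − 1) } is strictly positive. -/
open MeasureTheory Filter

/-- With `κ, σ, η, T > 0`, `0 < α < β`, a nonnegative random variable `J`
whose moment generating function `M_J(t) = E[exp (t J)]` is finite exactly for `t < ε_J`
(with `ε_J > 0`) and blows up as `t → ε_J⁻`, and with
`D(c) = √(κ² − 2σ²c)`, `Λ(c) = 2ηc(e^{D(c)T} − 1)/(D(c) − κ + (D(c) + κ)e^{D(c)T})` for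
`c ≤ κ²/(2σ²)`, the quantity
`c_l = sup{c ≤ κ²/(2σ²) : Λ(c) < ε_J and M_J(Λ(c)) ≤ (β/α)·exp(α/β − 1)}`
is strictly positive. -/
theorem stmt_1
    {Ω : Type*} [MeasurableSpace Ω] (P : Measure Ω) [IsProbabilityMeasure P]
    (κ σ η T α β : ℝ)
    (hκ : 0 < κ) (hσ : 0 < σ) (hη : 0 < η) (hT : 0 < T) (hα : 0 < α) (hαβ : α < β)
    (J : Ω → ℝ) (hJmeas : Measurable J) (hJnonneg : ∀ ω, 0 ≤ J ω)
    (εJ : ℝ) (hεJ : 0 < εJ)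
    (MJ : ℝ → ℝ) (hMJ : ∀ t, MJ t = ∫ ω, Real.exp (t * J ω) ∂P)
    (hMJfin : ∀ t < εJ, Integrable (fun ω => Real.exp (t * J ω)) P)
    (hMJblow : Tendsto MJ (nhdsWithin εJ (Set.Iio εJ)) atTop)
    (D Λ : ℝ → ℝ)
    (hD : ∀ c, D c = Real.sqrt (κ ^ 2 - 2 * σ ^ 2 * c))
    (hΛ : ∀ c, Λ c = 2 * η * c * (Real.exp (D c * T) - 1) /
        (D c - κ + (D c + κ) * Real.exp (D c * T))) :
    0 < sSup {c : ℝ | c ≤ κ ^ 2 / (2 * σ ^ 2) ∧ Λ c < εJ ∧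
        MJ (Λ c) ≤ (β / α) * Real.exp (α / β - 1)} := by
  have hD0 : D 0 = κ := by simp [hD, Real.sqrt_sq hκ.le]
  have hΛ0 : Λ 0 = 0 := by simp [hΛ]
  have hDcont : Continuous D := by
    rw [funext hD]
    fun_prop
  have hΛcont : ContinuousAt Λ 0 := by
    rw [funext hΛ]
    refine ContinuousAt.div (by fun_prop) (by fun_prop) ?_
    rw [hD0, sub_self, zero_add]
    positivity
  have hMmgf : MJ = ProbabilityTheory.mgf J P := funext hMJ
  have hMcont : ContinuousAt MJ 0 := by
    rw [hMmgf]
    refine (ProbabilityTheory.analyticAt_mgf ?_).continuousAt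
    exact interior_maximal (fun t ht => hMJfin t ht) isOpen_Iio hεJ
  have hM0 : MJ 0 = 1 := by simp [hMJ]
  have hbound : 1 < (β / α) * Real.exp (α / β - 1) := by
    have hβ : 0 < β := hα.trans hαβ
    have hne : α / β - 1 ≠ 0 := (sub_neg.2 ((div_lt_one hβ).2 hαβ)).ne
    have hexp : α / β < Real.exp (α / β - 1) := by
      linarith [Real.add_one_lt_exp hne]
    calc (1 : ℝ) = (β / α) * (α / β) := by field_simp
      _ < _ := by gcongr
  have hcomp : ContinuousAt (fun c => MJ (Λ c)) 0 :=
    ContinuousAt.comp (g := MJ) (by rwa [hΛ0]) hΛcont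
  have hev : ∀ᶠ c in nhds (0 : ℝ), c ≤ κ ^ 2 / (2 * σ ^ 2) ∧ Λ c < εJ ∧
      MJ (Λ c) ≤ (β / α) * Real.exp (α / β - 1) := by
    filter_upwards [eventually_le_nhds (show (0 : ℝ) < κ ^ 2 / (2 * σ ^ 2) by positivity),
      hΛcont.eventually_lt continuousAt_const (by simpa [hΛ0] using hεJ),
      hcomp.eventually_lt continuousAt_const (by simpa [hΛ0, hM0] using hbound)]
      with c h₁ h₂ h₃
    exact ⟨h₁, h₂, h₃.le⟩
  obtain ⟨c, hc, hcpos⟩ :=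
    ((hev.filter_mono nhdsWithin_le_nhds).and
      (self_mem_nhdsWithin : Set.Ioi (0 : ℝ) ∈ nhdsWithin 0 (Set.Ioi 0))).exists
  exact lt_csSup_of_lt ⟨κ ^ 2 / (2 * σ ^ 2), fun _ hx => hx.1⟩ hc hcpos
end

section
/- For all 0 ≤ s ≤ t ≤ T and every A ∈ ℱ_s, ∫_A X_t · (∫_0^t λ_u du) dℙ = ∫_A X_s · (∫_0^s λ_u du) dℙ + ∫_s^t (∫_A λ_u · X_u dℙ) du; that is, almost surely E[X_t · ∫_0^t λ_u du | ℱ_s] = X_s · ∫_0^s λ_u du + ∫_s^t E[λ_u · X_u | ℱ_s] du. -/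
open MeasureTheory ProbabilityTheory

/-- Over a set of `m`, an `m`-measurable factor does not see the difference between `Y` and its
conditional expectation given `m`. -/
theorem setIntegral_mul_eq_of_condExp_ae_eq {Ω : Type*} {m mΩ : MeasurableSpace Ω}
    {P : Measure Ω} [IsFiniteMeasure P] (hm : m ≤ mΩ) {f Y Z : Ω → ℝ}
    (hf : StronglyMeasurable[m] f) (hY : Integrable Y P)
    (hfY : Integrable (fun ω => f ω * Y ω) P) (hZ : P[Y | m] =ᵐ[P] Z)
    {A : Set Ω} (hA : MeasurableSet[m] A) :
    ∫ ω in A, f ω * Y ω ∂P = ∫ ω in A, f ω * Z ω ∂P := by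
  rw [← setIntegral_condExp hm hfY hA]
  refine integral_congr_ae (ae_restrict_of_ae ?_)
  filter_upwards [condExp_mul_of_stronglyMeasurable_left hf hfY hY, hZ] with ω h₁ h₂
  exact h₁.trans (by simp [h₂])

/-- If the expectations `∫ l u * |Y|` are finite and integrable over `[0, t]`, then `l u * Y` is
integrable over the product of `(0, t]` with any set of outcomes. -/
theorem integrable_uncurry_mul_prod_restrict {Ω : Type*} {mΩ : MeasurableSpace Ω}
    {P : Measure Ω} [IsFiniteMeasure P] {t : ℝ} {l : ℝ → Ω → ℝ} {Y : Ω → ℝ}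
    (hl : ∀ u ω, 0 ≤ l u ω) (hmeas : Measurable (Function.uncurry l)) (hY : Measurable Y)
    (hint : ∀ u, 0 ≤ u → u ≤ t → Integrable (fun ω => l u ω * Y ω) P)
    (hfin : (∫⁻ u in Set.Icc (0 : ℝ) t, ENNReal.ofReal (∫ ω, l u ω * |Y ω| ∂P)) < ⊤)
    (A : Set Ω) :
    Integrable (Function.uncurry fun u ω => l u ω * Y ω)
      ((volume.restrict (Set.Ioc (0 : ℝ) t)).prod (P.restrict A)) := by
  have hm : Measurable (Function.uncurry fun u ω => l u ω * Y ω) :=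
    hmeas.mul (hY.comp measurable_snd)
  suffices h : Integrable (Function.uncurry fun u ω => l u ω * Y ω)
      ((volume.restrict (Set.Ioc (0 : ℝ) t)).prod P) from
    h.mono_measure (Measure.prod_mono le_rfl Measure.restrict_le_self)
  refine ⟨hm.aestronglyMeasurable, ?_⟩
  rw [hasFiniteIntegral_iff_enorm, lintegral_prod _ hm.enorm.aemeasurable]
  refine lt_of_le_of_lt ?_ hfin
  refine le_trans (le_of_eq ?_) (lintegral_mono_set Set.Ioc_subset_Icc_self)
  refine setLIntegral_congr_fun measurableSet_Ioc fun u hu => ?_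
  have habs (ω : Ω) : l u ω * |Y ω| = ‖l u ω * Y ω‖ := by
    rw [norm_mul, Real.norm_of_nonneg (hl u ω), Real.norm_eq_abs]
  simp only [habs, Function.uncurry_apply_pair]
  exact (ofReal_integral_norm_eq_lintegral_enorm (hint u hu.1.le hu.2)).symm

/-- Let `X` be a `((ℱ_t), P)`-martingale and `λ` a nonnegative, adapted,
jointly measurable process such that `λ_u · X_t` is integrable for `u ≤ t` and
`∫_0^t E[λ_u |X_t|] du < ∞`.  Then for all `0 ≤ s ≤ t ≤ T` and every `A ∈ ℱ_s`,
`∫_A X_t (∫_0^t λ_u du) dP = ∫_A X_s (∫_0^s λ_u du) dP + ∫_s^t (∫_A λ_u X_u dP) du`. -/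
theorem stmt_5
    {Ω : Type*} {mΩ : MeasurableSpace Ω} (P : Measure Ω) [IsProbabilityMeasure P]
    (T : ℝ) (hT : 0 < T)
    (ℱ : ℝ → MeasurableSpace Ω)
    (hℱmono : ∀ s t, s ≤ t → ℱ s ≤ ℱ t) (hℱle : ∀ t, ℱ t ≤ mΩ)
    (X : ℝ → Ω → ℝ)
    (hXadapted : ∀ t ∈ Set.Icc (0 : ℝ) T, StronglyMeasurable[ℱ t] (X t))
    (hXint : ∀ t ∈ Set.Icc (0 : ℝ) T, Integrable (X t) P)
    (hXmart : ∀ s ∈ Set.Icc (0 : ℝ) T, ∀ t ∈ Set.Icc (0 : ℝ) T, s ≤ t →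
      P[X t | ℱ s] =ᵐ[P] X s)
    (lam : ℝ → Ω → ℝ)
    (hlam_nonneg : ∀ u ω, 0 ≤ lam u ω)
    (hlam_adapted : ∀ u ∈ Set.Icc (0 : ℝ) T, StronglyMeasurable[ℱ u] (lam u))
    (hlam_meas : Measurable (Function.uncurry lam))
    (hlamX_int : ∀ u t, 0 ≤ u → u ≤ t → t ≤ T →
      Integrable (fun ω => lam u ω * X t ω) P)
    (hlamX_fin : ∀ t ∈ Set.Icc (0 : ℝ) T,
      (∫⁻ u in Set.Icc (0 : ℝ) t, ENNReal.ofReal (∫ ω, lam u ω * |X t ω| ∂P)) < ⊤) :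
    ∀ s t, 0 ≤ s → s ≤ t → t ≤ T → ∀ A : Set Ω, MeasurableSet[ℱ s] A →
      (∫ ω in A, X t ω * (∫ u in (0 : ℝ)..t, lam u ω) ∂P)
        = (∫ ω in A, X s ω * (∫ u in (0 : ℝ)..s, lam u ω) ∂P)
          + ∫ u in s..t, (∫ ω in A, lam u ω * X u ω ∂P) := by
  intro s t hs hst htT A hA
  have hprod (r : ℝ) (h0 : 0 ≤ r) (hT : r ≤ T) :=
    integrable_uncurry_mul_prod_restrict (P := P) hlam_nonneg hlam_meas
      ((hXadapted r ⟨h0, hT⟩).mono (hℱle r)).measurable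
      (fun u hu hur => hlamX_int u r hu hur hT) (hlamX_fin r ⟨h0, hT⟩) A
  have hswap (r : ℝ) (h0 : 0 ≤ r) (hT : r ≤ T) :
      ∫ ω in A, X r ω * (∫ u in (0 : ℝ)..r, lam u ω) ∂P
        = ∫ u in (0 : ℝ)..r, ∫ ω in A, lam u ω * X r ω ∂P := by
    simp only [intervalIntegral.integral_of_le h0]
    rw [integral_integral_swap (hprod r h0 hT)]
    simp only [integral_mul_const, mul_comm (X r _)]
  have ht : 0 ≤ t := hs.trans hst
  have hint : IntervalIntegrable (fun u => ∫ ω in A, lam u ω * X t ω ∂P) volume 0 t :=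
    (intervalIntegrable_iff_integrableOn_Ioc_of_le ht).2 (hprod t ht htT).integral_prod_left
  have hs_mem : s ∈ Set.uIcc 0 t := by rw [Set.uIcc_of_le ht]; exact ⟨hs, hst⟩
  rw [hswap t ht htT, hswap s hs (hst.trans htT),
    ← intervalIntegral.integral_add_adjacent_intervals
      (hint.mono_set (Set.uIcc_subset_uIcc_left hs_mem))
      (hint.mono_set (Set.uIcc_subset_uIcc_right hs_mem))]
  have hmart (u r : ℝ) (hu : 0 ≤ u) (hur : u ≤ r) (hsr : s ≤ r) (hrt : r ≤ t) :
      ∫ ω in A, lam u ω * X t ω ∂P = ∫ ω in A, lam u ω * X r ω ∂P :=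
    have hr : r ∈ Set.Icc 0 T := ⟨hu.trans hur, hrt.trans htT⟩
    setIntegral_mul_eq_of_condExp_ae_eq (hℱle r)
      ((hlam_adapted u ⟨hu, hur.trans hr.2⟩).mono (hℱmono u r hur)) (hXint t ⟨ht, htT⟩)
      (hlamX_int u t hu (hur.trans hrt) htT) (hXmart r hr t ⟨ht, htT⟩ hrt)
      (hℱmono s r hsr A hA)
  congr 1
  · refine intervalIntegral.integral_congr fun u hu => ?_
    rw [Set.uIcc_of_le hs] at hu
    exact hmart u s hu.1 hu.2 le_rfl hst
  · refine intervalIntegral.integral_congr fun u hu => ?_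
    rw [Set.uIcc_of_le hst] at hu
    exact hmart u u (hs.trans hu.1) le_rfl hu.1 hu.2
end
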